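/- Let n be a positive integer with n ≡ 3 (mod 4). Then Σ_{k=0}^{(n−1)/2} [6k−1]_q · (q^{−1}; q^4)_k (q^{−1}; q²)_k (q; q²)_k² / ((q²; q²)_k (q^4; q^4)_k (q²; q^4)_k²) · q^{k²+k+1} ≡ 0 (mod Φ_n(q)^3). -/

import Mathlib

open Finset

noncomputable section

abbrev R1 : Type := Polynomial ℚ
abbrev K1 : Type := FractionRing R1

/-- The variable `q` as a rational function in `ℚ(q)`. -/
def qv : K1 := algebraMap R1 K1 Polynomial.X

/-- The q-shifted factorial `(a; q)_k = (1-a)(1-aq)⋯(1-aq^{k-1})`. -/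
def qPoch {R : Type*} [CommRing R] (a q : R) (k : ℕ) : R :=
  ∏ j ∈ Finset.range k, (1 - a * q ^ j)

/-- The q-integer `[m]_q = (1 - q^m)/(1 - q)`. -/
def qInt {K : Type*} [Field K] (q : K) (m : ℤ) : K := (1 - q ^ m) / (1 - q)

/-- `A ≡ B (mod M)`: the polynomial `M` divides the numerator of the reduced form
of the rational function `A - B`. -/
def CongrMod1 (A B : K1) (M : R1) : Prop :=
  ∃ f g : R1, g ≠ 0 ∧ (∀ p : R1, Prime p → p ∣ g → ¬ p ∣ M) ∧
    (A - B) * algebraMap R1 K1 g = algebraMap R1 K1 M * algebraMap R1 K1 f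

section Summation

variable {K : Type*} [Field K]

/-- `(1 - c q^{2j+1}) (1 - q^{2j+1} / c)` in terms of `y = q (c + 1 / c)`. -/
def numFactor (q y : K) (j : ℕ) : K := 1 - y * q ^ (2 * j) + q ^ (4 * j + 2)

/-- `(1 - c q^{4j+2}) (1 - q^{4j+2} / c)` in terms of `y = q (c + 1 / c)`. -/
def denFactor (q y : K) (j : ℕ) : K := 1 - y * q ^ (4 * j + 1) + q ^ (8 * j + 4)

/-- The part of the term ratio that does not involve `y`; `e = 1 / d` is a free parameter,
which equals `q` in the sum of interest. -/
def coefRatio (q e : K) (j : ℕ) : K :=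
  (q - q ^ (2 * j)) * (e - q ^ (4 * j)) * q ^ (2 * j) /
    ((1 - q ^ (4 * j + 4)) * (1 - e * q ^ (2 * j + 1)))

/-- The hypergeometric part of the summand. -/
def quadProd (q e y : K) (k : ℕ) : K :=
  ∏ j ∈ range k, coefRatio q e j * numFactor q y j / denFactor q y j

/-- The truncated quadratic sum with parameters `e` and `y`. -/
def quadSum (q e y : K) (M : ℕ) : K :=
  ∑ k ∈ range M, (q - q ^ (6 * k)) * quadProd q e y k

theorem quadProd_succ (q e y : K) (k : ℕ) :
    quadProd q e y (k + 1) =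
      quadProd q e y k * (coefRatio q e k * numFactor q y k / denFactor q y k) :=
  prod_range_succ _ _

theorem quadProd_eq_zero_of_factor {q e y : K} {j k : ℕ} (hjk : j < k)
    (h : coefRatio q e j * numFactor q y j = 0) : quadProd q e y k = 0 :=
  prod_eq_zero (mem_range.2 hjk) (by rw [h, zero_div])

theorem quadProd_shift_e {q e y : K} (hq1 : ∀ m : ℕ, 0 < m → 1 - q ^ m ≠ 0)
    (he : ∀ j : ℕ, 1 - e * q ^ (2 * j + 1) ≠ 0) (k : ℕ) :
    quadProd q e y k * (q ^ (4 * k) * (e * q ^ 4 - 1) * (1 - e * q) * (1 - e * q ^ 3)) =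
      quadProd q (e * q ^ 4) y k * ((e * q ^ 4 - q ^ (4 * k)) * (1 - e * q ^ (2 * k + 1)) *
        (1 - e * q ^ (2 * k + 3))) := by
  induction k with
  | zero => simp [quadProd]
  | succ k ih =>
    have h1 := hq1 (4 * k + 4) (by omega)
    have h2 := he k
    have h3 := he (k + 2)
    rw [quadProd_succ, quadProd_succ]
    have key : coefRatio q e k * (q ^ 4 * (e * q ^ 4 - q ^ (4 * k)) * (1 - e * q ^ (2 * k + 1)))
        = coefRatio q (e * q ^ 4) k * ((e * q ^ 4 - q ^ (4 * (k + 1)))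
          * (1 - e * q ^ (2 * (k + 1) + 3))) := by
      have h3' : 1 - e * q ^ 4 * q ^ (2 * k + 1) ≠ 0 := by
        convert h3 using 2; ring
      unfold coefRatio
      rw [div_mul_eq_mul_div, div_mul_eq_mul_div, div_eq_div_iff (by positivity) (by positivity)]
      ring
    linear_combination
      (numFactor q y k / denFactor q y k * coefRatio q e k * q ^ 4) * ih +
      (numFactor q y k / denFactor q y k * quadProd q (e * q ^ 4) y k *
        (1 - e * q ^ (2 * k + 3))) * key


/-- Telescoping (WZ) relation for the shift `e ↦ e q ^ 4`. -/
theorem telescope_e {q e y : K} (hq : q ≠ 0) (hq1 : ∀ m : ℕ, 0 < m → 1 - q ^ m ≠ 0)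
    (he : ∀ j : ℕ, 1 - e * q ^ (2 * j + 1) ≠ 0) (he4 : e * q ^ 4 - 1 ≠ 0)
    (hd : ∀ j, denFactor q y j ≠ 0) (M : ℕ) :
    (1 - y * e * q + e ^ 2 * q ^ 4) * quadSum q (e * q ^ 4) y M -
      (1 - e * q) * (1 - e * q ^ 3) * quadSum q e y M =
    quadProd q (e * q ^ 4) y M * (e * q * (1 - q ^ (4 * M)) *
      (q ^ 4 - y * q * q ^ (4 * M) + q ^ (8 * M)) * (1 - e * q ^ (2 * M + 3)) /
        (q ^ (4 * M) * (e * q ^ 4 - 1))) := by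
  induction M with
  | zero => simp [quadSum]
  | succ M ih =>
    have h1 := hq1 (4 * M + 4) (by omega)
    have h3 : 1 - e * q ^ 4 * q ^ (2 * M + 1) ≠ 0 := by
      convert he (M + 2) using 2; ring
    have h4 := hd M
    have hB : quadProd q e y M * ((1 - e * q) * (1 - e * q ^ 3)) =
        quadProd q (e * q ^ 4) y M * ((e * q ^ 4 - q ^ (4 * M)) * (1 - e * q ^ (2 * M + 1)) *
          (1 - e * q ^ (2 * M + 3))) / (q ^ (4 * M) * (e * q ^ 4 - 1)) := by
      rw [eq_div_iff (by positivity), ← quadProd_shift_e hq1 he]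
      ring
    have hS (e : K) : quadSum q e y (M + 1) =
        quadSum q e y M + (q - q ^ (6 * M)) * quadProd q e y M := sum_range_succ _ _
    rw [hS, hS, quadProd_succ]
    have key : (1 - y * e * q + e ^ 2 * q ^ 4) * (q - q ^ (6 * M)) -
        (q - q ^ (6 * M)) * (((e * q ^ 4 - q ^ (4 * M)) * (1 - e * q ^ (2 * M + 1)) *
          (1 - e * q ^ (2 * M + 3))) / (q ^ (4 * M) * (e * q ^ 4 - 1))) =
        (coefRatio q (e * q ^ 4) M * numFactor q y M / denFactor q y M) *
          (e * q * (1 - q ^ (4 * (M + 1))) *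
      (q ^ 4 - y * q * q ^ (4 * (M + 1)) + q ^ (8 * (M + 1))) *
        (1 - e * q ^ (2 * (M + 1) + 3)) / (q ^ (4 * (M + 1)) * (e * q ^ 4 - 1))) -
        e * q * (1 - q ^ (4 * M)) *
      (q ^ 4 - y * q * q ^ (4 * M) + q ^ (8 * M)) * (1 - e * q ^ (2 * M + 3)) /
        (q ^ (4 * M) * (e * q ^ 4 - 1)) := by
      have hs : (coefRatio q (e * q ^ 4) M * numFactor q y M / denFactor q y M) *
          (e * q * (1 - q ^ (4 * (M + 1))) *
      (q ^ 4 - y * q * q ^ (4 * (M + 1)) + q ^ (8 * (M + 1))) *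
        (1 - e * q ^ (2 * (M + 1) + 3)) / (q ^ (4 * (M + 1)) * (e * q ^ 4 - 1))) =
        (q - q ^ (2 * M)) * (e * q ^ 4 - q ^ (4 * M)) * q ^ (2 * M) * numFactor q y M *
        (e * q) * q ^ 4 / (q ^ (4 * (M + 1)) * (e * q ^ 4 - 1)) := by
        have : q ^ 4 - y * q * q ^ (4 * (M + 1)) + q ^ (8 * (M + 1)) =
          q ^ 4 * denFactor q y M := by unfold denFactor; ring
        rw [this]
        have : 1 - e * q ^ (2 * (M + 1) + 3) = 1 - e * q ^ 4 * q ^ (2 * M + 1) := by ring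
        rw [this, mul_add_one]
        unfold coefRatio
        generalize 1 - e * q ^ 4 * q ^ (2 * M + 1) = v at h3 ⊢
        field_simp
      rw [hs]
      unfold numFactor
      rw [show q ^ (4 * (M + 1)) = q ^ (4 * M) * q ^ 4 by ring]
      field_simp
      ring
    linear_combination ih + quadProd q (e * q ^ 4) y M * key - (q - q ^ (6 * M)) * hB


/-- The argument `y` for which the factors split over `h`. -/
def splitArg (q h : K) : K := q * (h + h⁻¹)

theorem numFactor_splitArg {q h : K} (hh : h ≠ 0) (j : ℕ) :
    numFactor q (splitArg q h) j =
      (1 - h * q ^ (2 * j + 1)) * (h - q ^ (2 * j + 1)) / h := by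
  unfold numFactor splitArg
  field_simp
  ring

theorem denFactor_splitArg {q h : K} (hh : h ≠ 0) (j : ℕ) :
    denFactor q (splitArg q h) j =
      (1 - h * q ^ (4 * j + 2)) * (h - q ^ (4 * j + 2)) / h := by
  unfold denFactor splitArg
  field_simp
  ring

/-- Nondegeneracy of the denominators at `splitArg q h`. -/
structure Nondeg (q h : K) : Prop where
  ne_zero : h ≠ 0
  one_sub_mul_pow : ∀ j : ℕ, 1 - h * q ^ j ≠ 0
  sub_pow : ∀ j : ℕ, h - q ^ (4 * j + 2) ≠ 0
  mul_sub_pow : ∀ j : ℕ, h * q ^ 2 - q ^ (4 * j) ≠ 0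

theorem Nondeg.denFactor_ne_zero {q h : K} (H : Nondeg q h) (j : ℕ) :
    denFactor q (splitArg q h) j ≠ 0 := by
  rw [denFactor_splitArg H.ne_zero]
  exact div_ne_zero (mul_ne_zero (H.one_sub_mul_pow _) (H.sub_pow _)) H.ne_zero

theorem factor_shift_h {q h : K} (hq : q ≠ 0) (H : Nondeg q h) (k : ℕ) :
    numFactor q (splitArg q (h * q ^ 4)) k / denFactor q (splitArg q (h * q ^ 4)) k =
      (1 - h * q ^ (2 * k + 5)) * (h * q ^ 3 - q ^ (2 * k)) /
        ((1 - h * q ^ (4 * k + 6)) * (q * (h * q ^ 2 - q ^ (4 * k)))) := by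
  have hh := H.ne_zero
  have h6 := H.one_sub_mul_pow (4 * k + 6)
  have hw := H.mul_sub_pow k
  have hh' : h * q ^ 4 ≠ 0 := by positivity
  rw [numFactor_splitArg hh', denFactor_splitArg hh', div_div_div_cancel_right₀ hh',
    show h * q ^ 4 - q ^ (4 * k + 2) = q ^ 2 * (h * q ^ 2 - q ^ (4 * k)) by ring,
    show h * q ^ 4 - q ^ (2 * k + 1) = q * (h * q ^ 3 - q ^ (2 * k)) by ring,
    show 1 - h * q ^ 4 * q ^ (4 * k + 2) = 1 - h * q ^ (4 * k + 6) by ring,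
    show 1 - h * q ^ 4 * q ^ (2 * k + 1) = 1 - h * q ^ (2 * k + 5) by ring,
    div_eq_div_iff (by positivity) (by positivity)]
  ring

theorem factor_splitArg {q h : K} (hh : h ≠ 0) (k : ℕ) :
    numFactor q (splitArg q h) k / denFactor q (splitArg q h) k =
      (1 - h * q ^ (2 * k + 1)) * (h - q ^ (2 * k + 1)) /
        ((1 - h * q ^ (4 * k + 2)) * (h - q ^ (4 * k + 2))) := by
  rw [numFactor_splitArg hh, denFactor_splitArg hh, div_div_div_cancel_right₀ hh]

theorem quadProd_shift_h {q e h : K} (hq : q ≠ 0) (H : Nondeg q h) (k : ℕ) :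
    quadProd q e (splitArg q (h * q ^ 4)) k *
      ((h * q ^ 3 - q ^ (2 * k)) * (h * q - q ^ (2 * k)) * (1 - h * q ^ (4 * k + 2))) =
    -quadProd q e (splitArg q h) k * ((1 - h * q ^ (2 * k + 1)) *
      (1 - h * q ^ (2 * k + 3)) * (h * q ^ 2 - q ^ (4 * k))) := by
  induction k with
  | zero => simp [quadProd]; ring
  | succ k ih =>
    have hh := H.ne_zero
    have h2 := H.one_sub_mul_pow (4 * k + 2)
    have h6 := H.one_sub_mul_pow (4 * k + 6)
    have hw := H.mul_sub_pow k
    have hv := H.sub_pow k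
    rw [quadProd_succ, quadProd_succ, mul_div_assoc, mul_div_assoc, factor_shift_h hq H,
      factor_splitArg hh]
    have e1 : (1 - h * q ^ (2 * k + 5)) * (h * q ^ 3 - q ^ (2 * k)) /
        ((1 - h * q ^ (4 * k + 6)) * (q * (h * q ^ 2 - q ^ (4 * k)))) *
        ((h * q ^ 3 - q ^ (2 * (k + 1))) * (h * q - q ^ (2 * (k + 1))) *
          (1 - h * q ^ (4 * (k + 1) + 2))) =
        ((h * q ^ 3 - q ^ (2 * k)) * (h * q - q ^ (2 * k)) * (1 - h * q ^ (4 * k + 2))) *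
        ((1 - h * q ^ (2 * k + 5)) * q * (h * q - q ^ (2 * (k + 1))) /
          ((1 - h * q ^ (4 * k + 2)) * (h * q ^ 2 - q ^ (4 * k)))) := by
      rw [div_mul_eq_mul_div, mul_div_assoc', div_eq_div_iff (by positivity) (by positivity)]
      ring
    have e2 : (1 - h * q ^ (2 * k + 1)) * (h - q ^ (2 * k + 1)) /
        ((1 - h * q ^ (4 * k + 2)) * (h - q ^ (4 * k + 2))) *
        ((1 - h * q ^ (2 * (k + 1) + 1)) *
          (1 - h * q ^ (2 * (k + 1) + 3)) * (h * q ^ 2 - q ^ (4 * (k + 1)))) =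
        ((1 - h * q ^ (2 * k + 1)) * (1 - h * q ^ (2 * k + 3)) * (h * q ^ 2 - q ^ (4 * k))) *
        ((1 - h * q ^ (2 * k + 5)) * q * (h * q - q ^ (2 * (k + 1))) /
          ((1 - h * q ^ (4 * k + 2)) * (h * q ^ 2 - q ^ (4 * k)))) := by
      rw [div_mul_eq_mul_div, mul_div_assoc', div_eq_div_iff (by positivity) (by positivity)]
      ring
    linear_combination (quadProd q e (splitArg q (h * q ^ 4)) k * coefRatio q e k) * e1 +
      (quadProd q e (splitArg q h) k * coefRatio q e k) * e2 +
      coefRatio q e k * ((1 - h * q ^ (2 * k + 5)) * q * (h * q - q ^ (2 * (k + 1))) /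
          ((1 - h * q ^ (4 * k + 2)) * (h * q ^ 2 - q ^ (4 * k)))) * ih

/-- Telescoping (WZ) relation for the shift `h ↦ h q ^ 4`, where `y = splitArg q h`. -/
theorem telescope_h {q h : K} (hq : q ≠ 0) (hq1 : ∀ m : ℕ, 0 < m → 1 - q ^ m ≠ 0)
    (H : Nondeg q h) (M : ℕ) :
    (1 - h * q ^ 3) * quadSum q q (splitArg q (h * q ^ 4)) M +
      q * (h * q - 1) * quadSum q q (splitArg q h) M =
    quadProd q q (splitArg q (h * q ^ 4)) M * (q * (1 - q ^ (4 * M)) * (1 - q ^ (2 * M)) *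
      (h ^ 2 * q ^ 4 - 1) * (1 - h * q ^ (4 * M + 2)) /
        ((1 - h * q ^ (2 * M + 1)) * (1 - h * q ^ (2 * M + 3)))) := by
  induction M with
  | zero => simp [quadSum]
  | succ M ih =>
    have h1 := H.one_sub_mul_pow (2 * M + 1)
    have h3 := H.one_sub_mul_pow (2 * M + 3)
    have h5 := H.one_sub_mul_pow (2 * M + 5)
    have h6 := H.one_sub_mul_pow (4 * M + 6)
    have hw := H.mul_sub_pow M
    have hm := hq1 (4 * M + 4) (by omega)
    have hm' := hq1 (2 * M + 2) (by omega)
    have hB : quadProd q q (splitArg q h) M =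
        -quadProd q q (splitArg q (h * q ^ 4)) M *
        (((h * q ^ 3 - q ^ (2 * M)) * (h * q - q ^ (2 * M)) * (1 - h * q ^ (4 * M + 2))) /
        ((1 - h * q ^ (2 * M + 1)) * (1 - h * q ^ (2 * M + 3)) * (h * q ^ 2 - q ^ (4 * M)))) := by
      rw [mul_div_assoc', eq_div_iff (by positivity)]
      linear_combination quadProd_shift_h (e := q) hq H M
    have hS (y : K) : quadSum q q y (M + 1) =
        quadSum q q y M + (q - q ^ (6 * M)) * quadProd q q y M := sum_range_succ _ _
    have hr : coefRatio q q M = (q - q ^ (2 * M)) * (q - q ^ (4 * M)) * q ^ (2 * M) /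
        ((1 - q ^ (4 * M + 4)) * (1 - q ^ (2 * M + 2))) := by
      unfold coefRatio; congr 2; ring
    have hs : coefRatio q q M * ((1 - h * q ^ (2 * M + 5)) * (h * q ^ 3 - q ^ (2 * M)) /
        ((1 - h * q ^ (4 * M + 6)) * (q * (h * q ^ 2 - q ^ (4 * M))))) *
        (q * (1 - q ^ (4 * (M + 1))) * (1 - q ^ (2 * (M + 1))) *
      (h ^ 2 * q ^ 4 - 1) * (1 - h * q ^ (4 * (M + 1) + 2)) /
        ((1 - h * q ^ (2 * (M + 1) + 1)) * (1 - h * q ^ (2 * (M + 1) + 3)))) =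
        (q - q ^ (2 * M)) * (q - q ^ (4 * M)) * q ^ (2 * M) * (h * q ^ 3 - q ^ (2 * M)) *
        (h ^ 2 * q ^ 4 - 1) / ((h * q ^ 2 - q ^ (4 * M)) * (1 - h * q ^ (2 * M + 3))) := by
      rw [hr, div_mul_div_comm, div_mul_div_comm, div_eq_div_iff]
      · ring
      · have : 1 - h * q ^ (2 * (M + 1) + 1) ≠ 0 := H.one_sub_mul_pow _
        have : 1 - h * q ^ (2 * (M + 1) + 3) ≠ 0 := H.one_sub_mul_pow _
        positivity
      · positivity
    have key : (1 - h * q ^ 3) * (q - q ^ (6 * M)) - q * (h * q - 1) * (q - q ^ (6 * M)) *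
        (((h * q ^ 3 - q ^ (2 * M)) * (h * q - q ^ (2 * M)) * (1 - h * q ^ (4 * M + 2))) /
        ((1 - h * q ^ (2 * M + 1)) * (1 - h * q ^ (2 * M + 3)) * (h * q ^ 2 - q ^ (4 * M)))) =
        (q - q ^ (2 * M)) * (q - q ^ (4 * M)) * q ^ (2 * M) * (h * q ^ 3 - q ^ (2 * M)) *
        (h ^ 2 * q ^ 4 - 1) / ((h * q ^ 2 - q ^ (4 * M)) * (1 - h * q ^ (2 * M + 3))) -
        (q * (1 - q ^ (4 * M)) * (1 - q ^ (2 * M)) *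
      (h ^ 2 * q ^ 4 - 1) * (1 - h * q ^ (4 * M + 2)) /
        ((1 - h * q ^ (2 * M + 1)) * (1 - h * q ^ (2 * M + 3)))) := by
      field_simp
      ring
    rw [hS, hS, quadProd_succ, mul_div_assoc, factor_shift_h hq H, hB]
    linear_combination ih + quadProd q q (splitArg q (h * q ^ 4)) M * key -
      quadProd q q (splitArg q (h * q ^ 4)) M * hs

theorem quadSum_mul_prod_denFactor {q y : K} (hq : q ≠ 0)
    (hq1 : ∀ m : ℕ, 0 < m → 1 - q ^ m ≠ 0) (hd : ∀ j, denFactor q y j ≠ 0)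
    {N M : ℕ} (hNM : N < M) :
    quadSum q (q ^ (4 * N)) y M * ∏ j ∈ range N, denFactor q y j =
      (q - 1) * ∏ j ∈ range (2 * N), (1 - q ^ (2 * j + 1)) := by
  induction N with
  | zero =>
    obtain ⟨M, rfl⟩ := Nat.exists_eq_succ_of_ne_zero hNM.ne'
    rw [quadSum, sum_range_succ', sum_eq_zero]
    · simp [quadProd]
    · intro k _
      rw [quadProd_eq_zero_of_factor k.succ_pos (by simp [coefRatio]), mul_zero]
  | succ N ih =>
    have he (j : ℕ) : 1 - q ^ (4 * N) * q ^ (2 * j + 1) ≠ 0 := by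
      rw [← pow_add]; exact hq1 _ (by omega)
    have he4 : q ^ (4 * N) * q ^ 4 - 1 ≠ 0 := by
      rw [← pow_add, ← neg_ne_zero, neg_sub]; exact hq1 _ (by omega)
    have h := telescope_e hq hq1 he he4 hd M
    rw [quadProd_eq_zero_of_factor hNM (by simp [coefRatio, mul_add, pow_add]), zero_mul] at h
    rw [show 4 * (N + 1) = 4 * N + 4 by ring, pow_add, prod_range_succ,
      show 2 * (N + 1) = 2 * N + 1 + 1 by ring, prod_range_succ, prod_range_succ]
    have hQ : 1 - y * q ^ (4 * N) * q + (q ^ (4 * N)) ^ 2 * q ^ 4 = denFactor q y N := by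
      unfold denFactor; ring
    rw [hQ] at h
    linear_combination (∏ j ∈ range N, denFactor q y j) * h +
      (1 - q ^ (4 * N) * q) * (1 - q ^ (4 * N) * q ^ 3) * ih (by omega)

theorem nondeg_pow {q : K} (hq : q ≠ 0) (hq1 : ∀ m : ℕ, 0 < m → 1 - q ^ m ≠ 0) (i : ℕ) :
    Nondeg q (q ^ (4 * i + 3)) := by
  have hne {a b : ℕ} (hab : a ≠ b) : q ^ a - q ^ b ≠ 0 := by
    rcases lt_or_gt_of_ne hab with h | h
    · obtain ⟨c, rfl⟩ := Nat.exists_eq_add_of_lt h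
      have := hq1 (c + 1) (by omega)
      rw [show q ^ a - q ^ (a + c + 1) = q ^ a * (1 - q ^ (c + 1)) by ring]
      positivity
    · obtain ⟨c, rfl⟩ := Nat.exists_eq_add_of_lt h
      have := hq1 (c + 1) (by omega)
      rw [show q ^ (b + c + 1) - q ^ b = -(q ^ b * (1 - q ^ (c + 1))) by ring]
      exact neg_ne_zero.2 (by positivity)
  refine ⟨by positivity, fun j => ?_, fun j => hne (by omega), fun j => ?_⟩
  · rw [← pow_add]; exact hq1 _ (by omega)
  · rw [← pow_add]; exact hne (by omega)

theorem quadSum_splitArg_eq_zero {q : K} (hq : q ≠ 0) (hq1 : ∀ m : ℕ, 0 < m → 1 - q ^ m ≠ 0)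
    {i M : ℕ} (hM : 2 * i + 2 ≤ M) : quadSum q q (splitArg q (q ^ (4 * i + 3))) M = 0 := by
  induction i with
  | zero =>
    obtain ⟨M, rfl⟩ := Nat.exists_eq_add_of_le' hM
    have hz : numFactor q (splitArg q (q ^ 3)) 1 = 0 := by
      rw [numFactor_splitArg (by positivity)]; simp
    simp only [quadSum, mul_zero, zero_add]
    rw [sum_range_succ', sum_range_succ', sum_eq_zero]
    · have h1 := hq1 1 one_pos
      have h2 := hq1 2 two_pos
      have h4 := hq1 4 (by omega)
      have h5 := hq1 5 (by omega)
      rw [pow_one] at h1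
      simp only [quadProd, zero_add, prod_range_one, prod_range_zero, mul_div_assoc,
        factor_splitArg (h := q ^ 3) (by positivity : q ^ 3 ≠ 0), coefRatio]
      rw [show q - q ^ (6 * 1) = q * (1 - q ^ 5) by ring,
        show 1 - q ^ 3 * q ^ (4 * 0 + 2) = 1 - q ^ 5 by ring,
        show q ^ 3 - q ^ (4 * 0 + 2) = - (q ^ 2 * (1 - q)) by ring,
        show 1 - q ^ (4 * 0 + 4) = 1 - q ^ 4 by ring,
        show 1 - q * q ^ (2 * 0 + 1) = 1 - q ^ 2 by ring]
      field_simp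
      ring
    · intro k _
      rw [quadProd_eq_zero_of_factor (j := 1) (by omega) (by rw [hz, mul_zero]), mul_zero]
  | succ i ih =>
    have h := telescope_h hq hq1 (nondeg_pow hq hq1 i) M
    rw [ih (by omega), ← pow_add, ← pow_add,
      show 4 * i + 3 + 4 = 4 * (i + 1) + 3 by ring, mul_zero, add_zero,
      quadProd_eq_zero_of_factor (j := 2 * i + 3) (by omega), zero_mul] at h
    · exact (mul_eq_zero.1 h).resolve_left (hq1 _ (by omega))
    · rw [numFactor_splitArg (by positivity)]
      simp [show 2 * (2 * i + 3) + 1 = 4 * (i + 1) + 3 by ring]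

end Summation

section Congruence

variable {K : Type*} [Field K] {A : Subring K}

theorem exists_prod_sub_prod_eq_mul {ι : Type*} {δ : K} (s : Finset ι) {f g : ι → K}
    (hf : ∀ j ∈ s, f j ∈ A) (hg : ∀ j ∈ s, g j ∈ A)
    (h : ∀ j ∈ s, ∃ a ∈ A, f j - g j = δ * a) :
    ∃ a ∈ A, ∏ j ∈ s, f j - ∏ j ∈ s, g j = δ * a := by
  classical
  induction s using Finset.induction_on with
  | empty => exact ⟨0, A.zero_mem, by simp⟩
  | insert i s hi ih =>
    simp only [mem_insert, forall_eq_or_imp] at hf hg h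
    obtain ⟨a, ha, hae⟩ := ih hf.2 hg.2 h.2
    obtain ⟨b, hb, hbe⟩ := h.1
    refine ⟨f i * a + b * ∏ j ∈ s, g j,
      add_mem (mul_mem hf.1 ha) (mul_mem hb (prod_mem hg.2)), ?_⟩
    rw [prod_insert hi, prod_insert hi]
    linear_combination f i * hae + (∏ j ∈ s, g j) * hbe

/-- The `y`-dependence of the `k`-th summand after clearing `denFactor`s. -/
def weight (q y : K) (L k : ℕ) : K :=
  (∏ j ∈ range k, numFactor q y j) * ∏ j ∈ Ico k L, denFactor q y j

/-- The `y`-free coefficient of the `k`-th summand. -/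
def coef (q e : K) (k : ℕ) : K := (q - q ^ (6 * k)) * ∏ j ∈ range k, coefRatio q e j

theorem quadSum_mul_prod_eq_sum {q e y : K} (hd : ∀ j, denFactor q y j ≠ 0) (L : ℕ) :
    quadSum q e y (L + 1) * ∏ j ∈ range L, denFactor q y j =
      ∑ k ∈ range (L + 1), coef q e k * weight q y L k := by
  rw [quadSum, sum_mul]
  refine sum_congr rfl fun k hk => ?_
  have hk' : k ≤ L := by simpa [Nat.lt_succ_iff] using hk
  have hne : ∏ j ∈ range k, denFactor q y j ≠ 0 := prod_ne_zero_iff.2 fun j _ => hd j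
  rw [← prod_range_mul_prod_Ico _ hk', quadProd, prod_div_distrib, prod_mul_distrib, coef, weight]
  field_simp

theorem numFactor_mem {q y : K} (hq : q ∈ A) (hy : y ∈ A) (j : ℕ) : numFactor q y j ∈ A :=
  add_mem (sub_mem A.one_mem (mul_mem hy (pow_mem hq _))) (pow_mem hq _)

theorem denFactor_mem {q y : K} (hq : q ∈ A) (hy : y ∈ A) (j : ℕ) : denFactor q y j ∈ A :=
  add_mem (sub_mem A.one_mem (mul_mem hy (pow_mem hq _))) (pow_mem hq _)

theorem exists_numFactor_sub {q : K} (hq : q ∈ A) (y z : K) (j : ℕ) :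
    ∃ a ∈ A, numFactor q y j - numFactor q z j = (y - z) * a :=
  ⟨-q ^ (2 * j), neg_mem (pow_mem hq _), by unfold numFactor; ring⟩

theorem exists_denFactor_sub {q : K} (hq : q ∈ A) (y z : K) (j : ℕ) :
    ∃ a ∈ A, denFactor q y j - denFactor q z j = (y - z) * a :=
  ⟨-q ^ (4 * j + 1), neg_mem (pow_mem hq _), by unfold denFactor; ring⟩

theorem exists_weight_sub {q y z : K} (hq : q ∈ A) (hy : y ∈ A) (hz : z ∈ A) (L k : ℕ) :
    ∃ a ∈ A, weight q y L k - weight q z L k = (y - z) * a := by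
  obtain ⟨a, ha, hae⟩ := exists_prod_sub_prod_eq_mul (range k)
    (fun j _ => numFactor_mem hq hy j) (fun j _ => numFactor_mem hq hz j)
    (fun j _ => exists_numFactor_sub hq y z j)
  obtain ⟨b, hb, hbe⟩ := exists_prod_sub_prod_eq_mul (Ico k L)
    (fun j _ => denFactor_mem hq hy j) (fun j _ => denFactor_mem hq hz j)
    (fun j _ => exists_denFactor_sub hq y z j)
  refine ⟨a * (∏ j ∈ Ico k L, denFactor q y j) + (∏ j ∈ range k, numFactor q z j) * b,
    add_mem (mul_mem ha (prod_mem fun j _ => denFactor_mem hq hy j))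
      (mul_mem (prod_mem fun j _ => numFactor_mem hq hz j) hb), ?_⟩
  unfold weight
  linear_combination (∏ j ∈ Ico k L, denFactor q y j) * hae +
    (∏ j ∈ range k, numFactor q z j) * hbe

theorem coefRatio_mem {q e : K} {j : ℕ} (hq : q ∈ A) (he : e ∈ A)
    (h4 : (1 - q ^ (4 * j + 4))⁻¹ ∈ A) (h2 : (1 - e * q ^ (2 * j + 1))⁻¹ ∈ A) :
    coefRatio q e j ∈ A := by
  rw [coefRatio, div_eq_mul_inv, mul_inv]
  exact mul_mem (mul_mem (mul_mem (sub_mem hq (pow_mem hq _)) (sub_mem he (pow_mem hq _)))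
    (pow_mem hq _)) (mul_mem h4 h2)

theorem exists_coefRatio_sub {q e e' : K} {j : ℕ} (hq : q ∈ A)
    (h4 : (1 - q ^ (4 * j + 4))⁻¹ ∈ A) (h2 : (1 - e * q ^ (2 * j + 1))⁻¹ ∈ A)
    (h2' : (1 - e' * q ^ (2 * j + 1))⁻¹ ∈ A) (hne : 1 - e * q ^ (2 * j + 1) ≠ 0)
    (hne' : 1 - e' * q ^ (2 * j + 1) ≠ 0) :
    ∃ a ∈ A, coefRatio q e j - coefRatio q e' j = (e - e') * a := by
  refine ⟨(q - q ^ (2 * j)) * q ^ (2 * j) * (1 - q ^ (6 * j + 1)) * ((1 - q ^ (4 * j + 4))⁻¹ *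
    (1 - e * q ^ (2 * j + 1))⁻¹ * (1 - e' * q ^ (2 * j + 1))⁻¹),
    mul_mem (mul_mem (mul_mem (sub_mem hq (pow_mem hq _)) (pow_mem hq _))
      (sub_mem A.one_mem (pow_mem hq _))) (mul_mem (mul_mem h4 h2) h2'), ?_⟩
  rw [coefRatio, coefRatio]
  simp only [div_eq_mul_inv, mul_inv]
  linear_combination
    (q - q ^ (2 * j)) * q ^ (2 * j) * (1 - q ^ (4 * j + 4))⁻¹ *
      ((e' - q ^ (4 * j)) * (1 - e' * q ^ (2 * j + 1))⁻¹ * mul_inv_cancel₀ hne -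
        (e - q ^ (4 * j)) * (1 - e * q ^ (2 * j + 1))⁻¹ * mul_inv_cancel₀ hne')

/-- The truncated sum, evaluated at `y = 2 q`, is divisible by `(1 - q ^ n) ^ 3` for
`n = 4 i + 3` over any subring in which `q` and all `1 - q ^ m` with `n ∤ m` are invertible. -/
theorem exists_quadSum_eq_mul {q : K} (i : ℕ) (hq0 : q ≠ 0)
    (hq1 : ∀ m : ℕ, 0 < m → 1 - q ^ m ≠ 0) (hq : q ∈ A) (hqi : q⁻¹ ∈ A)
    (hinv : ∀ m : ℕ, ¬ (4 * i + 3) ∣ m → (1 - q ^ m)⁻¹ ∈ A) :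
    ∃ a ∈ A, quadSum q q (2 * q) (2 * i + 2) = (1 - q ^ (4 * i + 3)) ^ 3 * a := by
  set n := 4 * i + 3 with hn
  set z := splitArg q (q ^ n) with hz
  have h2A : (2 : K) ∈ A := by exact_mod_cast natCast_mem A 2
  have hy : 2 * q ∈ A := mul_mem h2A hq
  have hzA : z ∈ A := by
    rw [hz, splitArg, ← inv_pow]
    exact mul_mem hq (add_mem (pow_mem hq _) (pow_mem hqi _))
  have hdz (j : ℕ) : denFactor q z j ≠ 0 := (nondeg_pow hq0 hq1 i).denFactor_ne_zero j
  have hdy' (j : ℕ) : denFactor q (2 * q) j = (1 - q ^ (4 * j + 2)) ^ 2 := by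
    unfold denFactor; ring
  have hdy (j : ℕ) : denFactor q (2 * q) j ≠ 0 := by
    rw [hdy']; exact pow_ne_zero _ (hq1 _ (by omega))
  have hδ : 2 * q - z = (1 - q ^ n) ^ 2 * (-q * q⁻¹ ^ n) := by
    rw [hz, splitArg, inv_pow]
    field_simp
    ring
  have hnd {m l : ℕ} (h1 : m = 2 * l) (h2 : 0 < l) (h3 : l < n) : ¬ n ∣ m := by
    intro h
    rw [h1] at h
    exact Nat.not_dvd_of_pos_of_lt h2 h3
      ((Nat.Coprime.dvd_mul_left (Nat.coprime_two_right.2 ⟨2 * i + 1, by omega⟩)).1 h)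
  have hnd' {m : ℕ} (h : ¬ n ∣ m) : ¬ n ∣ n + m := by rwa [Nat.dvd_add_right (dvd_refl n)]
  have hc (k : ℕ) : ∃ a ∈ A, k ∈ range (2 * i + 2) →
      coef q q k - coef q (q ^ (4 * (i + 1))) k = (1 - q ^ n) * a := by
    by_cases hk : k ∈ range (2 * i + 2)
    swap
    · exact ⟨0, A.zero_mem, fun h => absurd h hk⟩
    have hk' := mem_range.1 hk
    have hlt {j : ℕ} (hj : j ∈ range k) : j < 2 * i + 1 := by
      have := mem_range.1 hj; omega
    have h4 (j : ℕ) (hj : j ∈ range k) : (1 - q ^ (4 * j + 4))⁻¹ ∈ A :=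
      hinv _ (hnd (l := 2 * j + 2) (by ring) (by omega) (by have := hlt hj; omega))
    have h2 (j : ℕ) (hj : j ∈ range k) : (1 - q * q ^ (2 * j + 1))⁻¹ ∈ A := by
      rw [← pow_succ']
      exact hinv _ (hnd (l := j + 1) (by ring) (by omega) (by have := hlt hj; omega))
    have h2' (j : ℕ) (hj : j ∈ range k) : (1 - q ^ (4 * (i + 1)) * q ^ (2 * j + 1))⁻¹ ∈ A := by
      rw [← pow_add, show 4 * (i + 1) + (2 * j + 1) = n + (2 * j + 2) by omega]
      exact hinv _ (hnd' (hnd (l := j + 1) (by ring) (by omega) (by have := hlt hj; omega)))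
    obtain ⟨a, ha, hae⟩ := exists_prod_sub_prod_eq_mul (range k)
      (fun j hj => coefRatio_mem hq hq (h4 j hj) (h2 j hj))
      (fun j hj => coefRatio_mem hq (pow_mem hq _) (h4 j hj) (h2' j hj))
      (fun j hj => exists_coefRatio_sub hq (h4 j hj) (h2 j hj) (h2' j hj)
        (by rw [← pow_succ']; exact hq1 _ (by omega))
        (by rw [← pow_add]; exact hq1 _ (by omega)))
    refine ⟨(q - q ^ (6 * k)) * (q * a),
      mul_mem (sub_mem hq (pow_mem hq _)) (mul_mem hq ha), fun _ => ?_⟩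
    unfold coef
    linear_combination (q - q ^ (6 * k)) * hae
  choose c hcA hc using hc
  choose V hVA hV using exists_weight_sub (A := A) hq hy hzA (2 * i + 1)
  obtain ⟨V', hVA', hV'⟩ := exists_prod_sub_prod_eq_mul (Ico (i + 1) (2 * i + 1))
    (fun j _ => denFactor_mem hq hy j) (fun j _ => denFactor_mem hq hzA j)
    (fun j _ => exists_denFactor_sub hq (2 * q) z j)
  have hSy := quadSum_mul_prod_eq_sum (e := q) hdy (2 * i + 1)
  have hSz := quadSum_mul_prod_eq_sum (e := q) hdz (2 * i + 1)
  rw [hz, hn, quadSum_splitArg_eq_zero hq0 hq1 (by omega), zero_mul, ← hn, ← hz] at hSz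
  have hclosed {y : K} (hd : ∀ j, denFactor q y j ≠ 0) :
      ∑ k ∈ range (2 * i + 2), coef q (q ^ (4 * (i + 1))) k * weight q y (2 * i + 1) k =
        (q - 1) * (∏ j ∈ range (2 * i + 1), (1 - q ^ (2 * j + 1))) * (1 - q ^ n) *
          ∏ j ∈ Ico (i + 1) (2 * i + 1), denFactor q y j := by
    rw [← quadSum_mul_prod_eq_sum hd,
      ← prod_range_mul_prod_Ico _ (show i + 1 ≤ 2 * i + 1 by omega), ← mul_assoc,
      quadSum_mul_prod_denFactor hq0 hq1 hd (by omega), mul_add_one, prod_range_succ,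
      show 2 * (2 * i + 1) + 1 = n by omega]
    ring
  have hDne : ∏ j ∈ range (2 * i + 1), denFactor q (2 * q) j ≠ 0 :=
    prod_ne_zero_iff.2 fun j _ => hdy j
  have hDinv : (∏ j ∈ range (2 * i + 1), denFactor q (2 * q) j)⁻¹ ∈ A := by
    rw [← prod_inv_distrib]
    refine prod_mem fun j hj => ?_
    rw [hdy', ← inv_pow]
    have := mem_range.1 hj
    exact pow_mem (hinv _ (hnd (l := 2 * j + 1) (by ring) (by omega) (by omega))) _
  set P := (q - 1) * ∏ j ∈ range (2 * i + 1), (1 - q ^ (2 * j + 1)) with hP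
  have hPA : P ∈ A := mul_mem (sub_mem hq A.one_mem)
    (prod_mem fun j _ => sub_mem A.one_mem (pow_mem hq _))
  set E := ∑ k ∈ range (2 * i + 2), c k * V k
  have hEA : E ∈ A := sum_mem fun k _ => mul_mem (hcA k) (hVA k)
  have hmain : quadSum q q (2 * q) (2 * i + 2) * ∏ j ∈ range (2 * i + 1), denFactor q (2 * q) j =
      (2 * q - z) * ((1 - q ^ n) * (P * V' + E)) := by
    have hsum : ∑ k ∈ range (2 * i + 2), coef q q k * weight q (2 * q) (2 * i + 1) k -
        ∑ k ∈ range (2 * i + 2), coef q q k * weight q z (2 * i + 1) k =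
        (∑ k ∈ range (2 * i + 2),
            coef q (q ^ (4 * (i + 1))) k * weight q (2 * q) (2 * i + 1) k -
          ∑ k ∈ range (2 * i + 2), coef q (q ^ (4 * (i + 1))) k * weight q z (2 * i + 1) k) +
        (2 * q - z) * (1 - q ^ n) * E := by
      rw [mul_sum, ← sum_sub_distrib, ← sum_sub_distrib, ← sum_add_distrib]
      refine sum_congr rfl fun k hk => ?_
      linear_combination (coef q q k - coef q (q ^ (4 * (i + 1))) k) * hV k +
        (2 * q - z) * V k * hc k hk
    rw [hclosed hdy, hclosed hdz] at hsum
    linear_combination hSy + hsum - hSz + P * (1 - q ^ n) * hV'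
  refine ⟨-q * q⁻¹ ^ n * (P * V' + E) * (∏ j ∈ range (2 * i + 1), denFactor q (2 * q) j)⁻¹,
    mul_mem (mul_mem (mul_mem (neg_mem hq) (pow_mem hqi _))
      (add_mem (mul_mem hPA hVA') hEA)) hDinv, ?_⟩
  rw [eq_div_of_mul_eq hDne hmain, hδ]
  ring

end Congruence

section Localization

open Polynomial

theorem qv_ne_zero : qv ≠ 0 :=
  (map_ne_zero_iff _ (IsFractionRing.injective R1 K1)).2 X_ne_zero

theorem one_sub_X_pow_ne_zero {m : ℕ} (hm : 0 < m) : (1 - X ^ m : R1) ≠ 0 := by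
  rw [← neg_ne_zero, neg_sub]
  simpa using X_pow_sub_C_ne_zero hm (1 : ℚ)

theorem one_sub_qv_pow (m : ℕ) : 1 - qv ^ m = algebraMap R1 K1 (1 - X ^ m) := by
  simp [qv]

theorem one_sub_qv_pow_ne_zero (m : ℕ) (hm : 0 < m) : 1 - qv ^ m ≠ 0 := by
  rw [one_sub_qv_pow]
  exact (map_ne_zero_iff _ (IsFractionRing.injective R1 K1)).2 (one_sub_X_pow_ne_zero hm)

/-- The rational functions whose denominator is prime to `p`. -/
def regularAt (p : R1) (hp : Prime p) : Subring K1 where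
  carrier := {x | ∃ f g : R1, ¬ p ∣ g ∧ x * algebraMap R1 K1 g = algebraMap R1 K1 f}
  mul_mem' := by
    rintro x y ⟨f, g, hg, h⟩ ⟨f', g', hg', h'⟩
    refine ⟨f * f', g * g', hp.not_dvd_mul hg hg', ?_⟩
    rw [map_mul, map_mul, ← h, ← h']
    ring
  one_mem' := ⟨1, 1, hp.not_dvd_one, by simp⟩
  add_mem' := by
    rintro x y ⟨f, g, hg, h⟩ ⟨f', g', hg', h'⟩
    refine ⟨f * g' + f' * g, g * g', hp.not_dvd_mul hg hg', ?_⟩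
    rw [map_add, map_mul, map_mul, map_mul, ← h, ← h']
    ring
  zero_mem' := ⟨0, 1, hp.not_dvd_one, by simp⟩
  neg_mem' := by
    rintro x ⟨f, g, hg, h⟩
    exact ⟨-f, g, hg, by rw [map_neg, ← h, neg_mul]⟩

theorem algebraMap_mem_regularAt {p : R1} (hp : Prime p) (f : R1) :
    algebraMap R1 K1 f ∈ regularAt p hp :=
  ⟨f, 1, hp.not_dvd_one, by simp⟩

theorem inv_algebraMap_mem_regularAt {p : R1} (hp : Prime p) {g : R1} (hg : ¬ p ∣ g) :
    (algebraMap R1 K1 g)⁻¹ ∈ regularAt p hp := by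
  have hg0 : g ≠ 0 := by rintro rfl; exact hg (dvd_zero p)
  exact ⟨1, g, hg, by
    rw [map_one, inv_mul_cancel₀ ((map_ne_zero_iff _ (IsFractionRing.injective R1 K1)).2 hg0)]⟩

theorem congrMod1_zero_of_eq_mul {p : R1} (hp : Prime p) {x a : K1} {m : ℕ}
    (ha : a ∈ regularAt p hp) (hx : x = algebraMap R1 K1 (p ^ m) * a) :
    CongrMod1 x 0 (p ^ m) := by
  obtain ⟨f, g, hg, h⟩ := ha
  refine ⟨f, g, ?_, fun r hr hrg hrp => hg ?_, ?_⟩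
  · rintro rfl; exact hg (dvd_zero p)
  · exact ((hr.associated_of_dvd hp (hr.dvd_of_dvd_pow hrp)).symm.dvd).trans hrg
  · rw [sub_zero, hx, ← h, mul_assoc]

theorem aeval_cyclotomic_exp {n : ℕ} (hn : 0 < n) :
    aeval (Complex.exp (2 * Real.pi * Complex.I / n)) (cyclotomic n ℚ) = 0 := by
  rw [aeval_def, eval₂_eq_eval_map, map_cyclotomic]
  exact (Complex.isPrimitiveRoot_exp n hn.ne').isRoot_cyclotomic hn

theorem not_cyclotomic_dvd_one_sub_X_pow {n m : ℕ} (hn : 0 < n) (h : ¬ n ∣ m) :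
    ¬ cyclotomic n ℚ ∣ 1 - X ^ m := by
  rintro ⟨r, hr⟩
  have := congrArg (aeval (Complex.exp (2 * Real.pi * Complex.I / n))) hr
  rw [map_mul, aeval_cyclotomic_exp hn, zero_mul, map_sub, map_one, map_pow, aeval_X,
    sub_eq_zero] at this
  exact h ((Complex.isPrimitiveRoot_exp n hn.ne').dvd_of_pow_eq_one m this.symm)

theorem not_cyclotomic_dvd_X {n : ℕ} (hn : 0 < n) : ¬ cyclotomic n ℚ ∣ X := by
  rintro ⟨r, hr⟩
  have := congrArg (aeval (Complex.exp (2 * Real.pi * Complex.I / n))) hr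
  rw [map_mul, aeval_cyclotomic_exp hn, zero_mul, aeval_X] at this
  exact Complex.exp_ne_zero _ this

end Localization

section Terms

variable {K : Type*} [Field K]

theorem qPoch_succ (a q : K) (k : ℕ) : qPoch a q (k + 1) = qPoch a q k * (1 - a * q ^ k) :=
  prod_range_succ _ _

theorem quadProd_two_mul {q : K} (hq : q ≠ 0) (k : ℕ) :
    quadProd q q (2 * q) k =
      qPoch q⁻¹ (q ^ 4) k * qPoch q⁻¹ (q ^ 2) k * qPoch q (q ^ 2) k ^ 2 /
        (qPoch (q ^ 2) (q ^ 2) k * qPoch (q ^ 4) (q ^ 4) k * qPoch (q ^ 2) (q ^ 4) k ^ 2) *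
          q ^ (k ^ 2 + k) := by
  induction k with
  | zero => simp [quadProd, qPoch]
  | succ k ih =>
    have key : coefRatio q q k * numFactor q (2 * q) k / denFactor q (2 * q) k =
        (1 - q⁻¹ * (q ^ 4) ^ k) * (1 - q⁻¹ * (q ^ 2) ^ k) * (1 - q * (q ^ 2) ^ k) ^ 2 /
        ((1 - q ^ 2 * (q ^ 2) ^ k) * (1 - q ^ 4 * (q ^ 4) ^ k) *
          (1 - q ^ 2 * (q ^ 4) ^ k) ^ 2) * q ^ (2 * k + 2) := by
      rw [show 1 - q⁻¹ * (q ^ 4) ^ k = (q - q ^ (4 * k)) * q⁻¹ by field_simp; ring,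
        show 1 - q⁻¹ * (q ^ 2) ^ k = (q - q ^ (2 * k)) * q⁻¹ by field_simp; ring,
        show numFactor q (2 * q) k = (1 - q * (q ^ 2) ^ k) ^ 2 by unfold numFactor; ring,
        show denFactor q (2 * q) k = (1 - q ^ 2 * (q ^ 4) ^ k) ^ 2 by unfold denFactor; ring,
        coefRatio, show 1 - q * q ^ (2 * k + 1) = 1 - q ^ 2 * (q ^ 2) ^ k by ring,
        show 1 - q ^ (4 * k + 4) = 1 - q ^ 4 * (q ^ 4) ^ k by ring,
        show q ^ (2 * k + 2) = q ^ (2 * k) * q * q by ring]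
      generalize 1 - q ^ 2 * (q ^ 4) ^ k = d₁
      generalize 1 - q ^ 2 * (q ^ 2) ^ k = d₂
      generalize 1 - q ^ 4 * (q ^ 4) ^ k = d₃
      field_simp
    rw [quadProd_succ, ih, key]
    simp only [qPoch_succ]
    rw [show (k + 1) ^ 2 + (k + 1) = (k ^ 2 + k) + (2 * k + 2) by ring, pow_add _ (k ^ 2 + k)]
    simp only [mul_pow, div_eq_mul_inv, mul_inv]
    ring

theorem qInt_mul_self {q : K} (hq : q ≠ 0) (k : ℕ) :
    qInt q (6 * (k : ℤ) - 1) * q = (q - q ^ (6 * k)) * (1 - q)⁻¹ := by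
  have : q ^ (6 * (k : ℤ) - 1) = q ^ (6 * k) * q⁻¹ := by
    rw [zpow_sub_one₀ hq]
    norm_cast
  rw [qInt, this, div_mul_eq_mul_div, div_eq_mul_inv, sub_mul, one_mul, mul_assoc,
    inv_mul_cancel₀ hq, mul_one]

end Terms

/-- Theorem 1.3, second case: for `n ≡ 3 (mod 4)`,
`Σ_{k=0}^{(n-1)/2} [6k-1] (q^{-1};q^4)_k (q^{-1};q^2)_k (q;q^2)_k² /
((q^2;q^2)_k (q^4;q^4)_k (q^2;q^4)_k²) q^{k²+k+1} ≡ 0 (mod Φ_n(q)^3)`. -/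
theorem stmt7 (n : ℕ) (hn : 0 < n) (hmod : n % 4 = 3) :
    CongrMod1
      (∑ k ∈ Finset.range ((n - 1) / 2 + 1),
        qInt qv (6 * (k : ℤ) - 1) *
          (qPoch (qv ^ (-1 : ℤ)) (qv ^ 4) k * qPoch (qv ^ (-1 : ℤ)) (qv ^ 2) k *
            qPoch qv (qv ^ 2) k ^ 2) /
          (qPoch (qv ^ 2) (qv ^ 2) k * qPoch (qv ^ 4) (qv ^ 4) k *
            qPoch (qv ^ 2) (qv ^ 4) k ^ 2) *
          qv ^ (k ^ 2 + k + 1))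
      0
      (Polynomial.cyclotomic n ℚ ^ 3) := by
  obtain ⟨i, rfl⟩ : ∃ i, n = 4 * i + 3 := ⟨n / 4, by omega⟩
  have hp : Prime (Polynomial.cyclotomic (4 * i + 3) ℚ) :=
    (Polynomial.cyclotomic.irreducible_rat hn).prime
  have hinv (m : ℕ) (hm : ¬ (4 * i + 3) ∣ m) : (1 - qv ^ m)⁻¹ ∈ regularAt _ hp := by
    rw [one_sub_qv_pow]
    exact inv_algebraMap_mem_regularAt hp (not_cyclotomic_dvd_one_sub_X_pow hn hm)
  obtain ⟨a, ha, hS⟩ := exists_quadSum_eq_mul i qv_ne_zero one_sub_qv_pow_ne_zero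
    (algebraMap_mem_regularAt hp _)
    (inv_algebraMap_mem_regularAt hp (not_cyclotomic_dvd_X hn)) hinv
  obtain ⟨r, hr⟩ : Polynomial.cyclotomic (4 * i + 3) ℚ ∣ 1 - Polynomial.X ^ (4 * i + 3) := by
    rw [← dvd_neg, neg_sub]
    exact Polynomial.cyclotomic.dvd_X_pow_sub_one _ _
  have h1 : (1 - qv)⁻¹ ∈ regularAt _ hp := by
    simpa using hinv 1 (by rw [Nat.dvd_one]; omega)
  refine congrMod1_zero_of_eq_mul hp
    (mul_mem (mul_mem (pow_mem (algebraMap_mem_regularAt hp r) 3) ha) h1) ?_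
  trans quadSum qv qv (2 * qv) (2 * i + 2) * (1 - qv)⁻¹
  · rw [show (4 * i + 3 - 1) / 2 + 1 = 2 * i + 2 by omega, quadSum, sum_mul]
    refine sum_congr rfl fun k _ => ?_
    rw [quadProd_two_mul qv_ne_zero, zpow_neg_one]
    linear_combination (qPoch qv⁻¹ (qv ^ 4) k * qPoch qv⁻¹ (qv ^ 2) k * qPoch qv (qv ^ 2) k ^ 2 /
      (qPoch (qv ^ 2) (qv ^ 2) k * qPoch (qv ^ 4) (qv ^ 4) k * qPoch (qv ^ 2) (qv ^ 4) k ^ 2) *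
        qv ^ (k ^ 2 + k)) * qInt_mul_self qv_ne_zero k
  · rw [hS, one_sub_qv_pow, hr, map_mul, map_pow]
    ring

end
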